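/- Let Γ₁ be a group acting on a set U₁, let Γ₂ be a group acting on a set U₂, let Θ : Γ₁ → Γ₂ be a group homomorphism, and let f : U₁ → U₂ be an injective Θ-equivariant map (f(γ • x) = Θ(γ) • f(x) for all γ ∈ Γ₁, x ∈ U₁). Assume that whenever γ₂ ∈ Γ₂ and x₁, x₂ ∈ U₁ satisfy γ₂ • f(x₁) = f(x₂), there exists γ₁ ∈ Γ₁ with γ₁ • x₁ = x₂. Let Δ₁ be a subgroup of Γ₁ and let V₁ ⊆ U₁ be a Δ₁-subset of U₁ (i.e., V₁ ∩ (Γ₁ • x) = Δ₁ • x for every x ∈ V₁). Then the image f(V₁) is a Θ(Δ₁)-subset of U₂: f(V₁) ∩ (Γ₂ • y) = Θ(Δ₁) • y for every y ∈ f(V₁). Moreover, if Δ₁ acts effectively on V₁ (δ • x = x for all x ∈ V₁ implies δ = 1), then Θ(Δ₁) acts effectively on f(V₁). -/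

import Mathlib

/-- Group-action core of Proposition 3.9: if `f : U₁ → U₂` is an injective `Θ`-equivariant
map inducing an injection on orbit spaces, and `V₁` is a `Δ₁`-subset of `U₁`, then `f(V₁)`
is a `Θ(Δ₁)`-subset of `U₂`; moreover if `Δ₁` acts effectively on `V₁` then `Θ(Δ₁)` acts
effectively on `f(V₁)`. -/
theorem stmt_14 {Γ₁ Γ₂ U₁ U₂ : Type*} [Group Γ₁] [Group Γ₂]
    [MulAction Γ₁ U₁] [MulAction Γ₂ U₂]
    (Θ : Γ₁ →* Γ₂) (f : U₁ → U₂) (hinj : Function.Injective f)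
    (hequiv : ∀ (γ : Γ₁) (x : U₁), f (γ • x) = Θ γ • f x)
    (horb : ∀ (γ₂ : Γ₂) (x₁ x₂ : U₁), γ₂ • f x₁ = f x₂ → ∃ γ₁ : Γ₁, γ₁ • x₁ = x₂)
    (Δ₁ : Subgroup Γ₁) (V₁ : Set U₁)
    (hV₁ : ∀ x ∈ V₁, V₁ ∩ MulAction.orbit Γ₁ x = MulAction.orbit Δ₁ x) :
    (∀ y ∈ f '' V₁, (f '' V₁) ∩ MulAction.orbit Γ₂ y = MulAction.orbit (Δ₁.map Θ) y) ∧
    ((∀ δ ∈ Δ₁, (∀ x ∈ V₁, δ • x = x) → δ = 1) →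
      ∀ δ₂ ∈ Δ₁.map Θ, (∀ y ∈ f '' V₁, δ₂ • y = y) → δ₂ = 1) := by
  refine ⟨?_, ?_⟩
  · rintro _ ⟨x, hx, rfl⟩
    ext z
    constructor
    · rintro ⟨⟨x', hx', rfl⟩, ⟨g, hg⟩⟩
      obtain ⟨γ, hγ⟩ := horb g x x' hg
      have h : x' ∈ MulAction.orbit Δ₁ x := by
        rw [← hV₁ x hx]
        exact ⟨hx', ⟨γ, hγ⟩⟩
      obtain ⟨⟨d, hd⟩, hdx⟩ := h
      have hdx' : d • x = x' := hdx
      refine ⟨⟨Θ d, Subgroup.mem_map_of_mem Θ hd⟩, ?_⟩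
      change Θ d • f x = f x'
      rw [← hequiv, hdx']
    · rintro ⟨⟨_, ⟨d, hd, rfl⟩⟩, rfl⟩
      have h : d • x ∈ V₁ ∩ MulAction.orbit Γ₁ x := by
        rw [hV₁ x hx]
        exact ⟨⟨d, hd⟩, rfl⟩
      exact ⟨⟨d • x, h.1, hequiv d x⟩, ⟨Θ d, rfl⟩⟩
  · rintro heff _ ⟨d, hd, rfl⟩ hfix
    have h : d = 1 := heff d hd fun x hx => hinj (by
      rw [hequiv]
      exact hfix (f x) ⟨x, hx, rfl⟩)
    rw [h]
    exact map_one Θ
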